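/- (Proposition 4: well-posedness of the stationary mean field game system, exchangeable case.) Let Ū > 0, L_U > 0, and let U be a map assigning to each x ∈ Ω and each Borel probability measure m on Ω a real number U(x, m) such that: x ↦ U(x, m) is continuous on Ω for every m; 0 ≤ U(x, m) ≤ Ū for all x and m; and |U(x, m) − U(x, ν)| ≤ L_U · TV(m, ν) for all x and all Borel probability measures m, ν. Let μ₀ be a Borel probability measure on Ω. Assume δ > ((3 + √5)/2) Ū and that C_δ := (L_U + Ū²/(2δ)) · (1 − δŪ/(δ − Ū)²)⁻¹ · (2δ/(δ − Ū)²) + 2Ū/δ < 1. Then there exists exactly one pair (m, Φ), where m is a Borel probability measure on Ω and Φ : Ω → ℝ is continuous with 0 ≤ Φ ≤ Ū on Ω, satisfying the coupled system: m(A) = ∫_A δ / (δ − (Φ(x) − ∫_Ω Φ dm)) μ₀(dx) for every Borel set A ⊆ Ω, and Φ(x) = U(x, m) + (1/(2δ)) ∫_Ω ((Φ(z) − Φ(x))₊)² m(dz) for every x ∈ Ω. Moreover m is absolutely continuous with respect to μ₀. -/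

import Mathlib

open MeasureTheory

/-- The action space `Ω = [0,1] ⊆ ℝ` with its Borel σ-algebra. -/
abbrev Ω : Type := Set.Icc (0:ℝ) 1

/-- Total variation distance between two (finite) Borel measures on `Ω`:
the total mass of the total variation of `μ − ν`, expressed via the Jordan
decomposition as `(μ − ν)(Ω) + (ν − μ)(Ω)` (truncated measure subtraction). -/
noncomputable def TV (μ ν : Measure Ω) : ℝ :=
  ((μ - ν) Set.univ + (ν - μ) Set.univ).toReal

/-- A pair `p = (m, Φ)` solves the stationary mean field game system:
`m` is a Borel probability measure, `Φ` is continuous with `0 ≤ Φ ≤ Ū`,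
`m(A) = ∫_A δ / (δ − (Φ(x) − ∫ Φ dm)) μ₀(dx)` for all Borel `A`, and
`Φ(x) = U(x,m) + (1/(2δ)) ∫ ((Φ(z) − Φ(x))₊)² m(dz)` for all `x`. -/
def MFGSol (Ubar δ : ℝ) (U : Ω → Measure Ω → ℝ) (μ0 : Measure Ω)
    (p : Measure Ω × (Ω → ℝ)) : Prop :=
  IsProbabilityMeasure p.1 ∧ Continuous p.2 ∧ (∀ x, 0 ≤ p.2 x ∧ p.2 x ≤ Ubar) ∧
  (∀ A : Set Ω, MeasurableSet A →
    p.1 A = ENNReal.ofReal (∫ x in A, δ / (δ - (p.2 x - ∫ z, p.2 z ∂p.1)) ∂μ0)) ∧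
  (∀ x, p.2 x = U x p.1 + (1 / (2 * δ)) * ∫ z, (max (p.2 z - p.2 x) 0) ^ 2 ∂p.1)

namespace MFGAux

/-- The density. -/
noncomputable def rho (δ : ℝ) (φ : Ω → ℝ) (c : ℝ) (x : Ω) : ℝ := δ / (δ - (φ x - c))

/-- The measure with that density. -/
noncomputable def M (δ : ℝ) (μ0 : Measure Ω) (φ : Ω → ℝ) (c : ℝ) : Measure Ω :=
  μ0.withDensity (fun x => ENNReal.ofReal (rho δ φ c x))

/-- Admissible pairs. -/
structure Adm (Ubar δ : ℝ) (μ0 : Measure Ω) (φ : Ω → ℝ) (c : ℝ) : Prop where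
  cont : Continuous φ
  bd : ∀ x, 0 ≤ φ x ∧ φ x ≤ Ubar
  c0 : 0 ≤ c
  int : ∫ x, rho δ φ c x ∂μ0 = 1

lemma den_pos {Ubar δ : ℝ} (h : Ubar < δ) {φ : Ω → ℝ} (bd : ∀ x, 0 ≤ φ x ∧ φ x ≤ Ubar)
    {c : ℝ} (hc : 0 ≤ c) (x : Ω) : 0 < δ - (φ x - c) := by
  have := (bd x).2; linarith

lemma rho_cont {Ubar δ : ℝ} (h : Ubar < δ) {φ : Ω → ℝ} (hφ : Continuous φ)
    (bd : ∀ x, 0 ≤ φ x ∧ φ x ≤ Ubar)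
    {c : ℝ} (hc : 0 ≤ c) : Continuous (rho δ φ c) := by
  unfold rho
  exact continuous_const.div (by fun_prop) (fun x => (den_pos h bd hc x).ne')

lemma integrable_of_cont {m : Measure Ω} [IsFiniteMeasure m] {f : Ω → ℝ} (hf : Continuous f) :
    Integrable f m := by
  have := hf.continuousOn.integrableOn_compact (μ := m) (isCompact_univ)
  simpa using this

lemma rho_nonneg {Ubar δ : ℝ} (h : Ubar < δ) (hU : 0 < Ubar) {φ : Ω → ℝ}
    (bd : ∀ x, 0 ≤ φ x ∧ φ x ≤ Ubar)
    {c : ℝ} (hc : 0 ≤ c) (x : Ω) : 0 ≤ rho δ φ c x :=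
  div_nonneg (by linarith) (den_pos h bd hc x).le

lemma exists_c {Ubar δ : ℝ} (h : Ubar < δ) (hU : 0 < Ubar) (μ0 : Measure Ω)
    [IsProbabilityMeasure μ0] {φ : Ω → ℝ} (hφ : Continuous φ)
    (bd : ∀ x, 0 ≤ φ x ∧ φ x ≤ Ubar) : ∃ c, Adm Ubar δ μ0 φ c := by
  have hδ : 0 < δ := by linarith
  have hcont : ContinuousOn (fun c => ∫ x, rho δ φ c x ∂μ0) (Set.Icc 0 Ubar) := by
    apply continuousOn_of_dominated (bound := fun _ => δ / (δ - Ubar))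
    · intro c hc
      exact (rho_cont h hφ bd hc.1).aestronglyMeasurable
    · intro c hc
      refine Filter.Eventually.of_forall fun x => ?_
      rw [Real.norm_of_nonneg (rho_nonneg h hU bd hc.1 x)]
      unfold rho
      apply div_le_div_of_nonneg_left hδ.le (by linarith)
      have := (bd x).2; have := hc.1; linarith
    · exact integrable_const _
    · refine Filter.Eventually.of_forall fun x => ?_
      unfold rho
      apply ContinuousOn.div continuousOn_const (by fun_prop)
      intro c hc
      exact (den_pos h bd hc.1 x).ne'
  have hmem : (1:ℝ) ∈ Set.Icc (∫ x, rho δ φ Ubar x ∂μ0) (∫ x, rho δ φ 0 x ∂μ0) := by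
    have h1 : ∫ x : Ω, (1:ℝ) ∂μ0 = 1 := by simp
    constructor
    · refine le_trans ?_ h1.le
      apply integral_mono (integrable_of_cont (rho_cont h hφ bd hU.le)) (integrable_const _)
      intro x
      show δ / (δ - (φ x - Ubar)) ≤ 1
      rw [div_le_one (den_pos h bd hU.le x)]
      have := (bd x).2; linarith
    · refine le_trans h1.ge ?_
      apply integral_mono (integrable_const _) (integrable_of_cont (rho_cont h hφ bd le_rfl))
      intro x
      show 1 ≤ δ / (δ - (φ x - 0))
      rw [one_le_div (den_pos h bd le_rfl x)]
      have := (bd x).1; linarith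
  obtain ⟨c, hc, hc1⟩ := intermediate_value_Icc' hU.le hcont hmem
  exact ⟨c, hφ, bd, hc.1, hc1⟩

lemma c_le {Ubar δ : ℝ} (h : Ubar < δ) (hU : 0 < Ubar) {μ0 : Measure Ω}
    [IsProbabilityMeasure μ0] {φ ψ : Ω → ℝ} {c d ε : ℝ}
    (hc : Adm Ubar δ μ0 φ c) (hd : Adm Ubar δ μ0 ψ d) (he : ∀ x, |φ x - ψ x| ≤ ε) :
    d ≤ c + ε := by
  by_contra! hlt
  have hδ : 0 < δ := by linarith
  have hpt : ∀ x, rho δ ψ d x < rho δ φ c x := by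
    intro x
    unfold rho
    apply div_lt_div_of_pos_left hδ (den_pos h hc.bd hc.c0 x)
    have := (abs_le.1 (he x)).1
    linarith
  have i1 := integrable_of_cont (m := μ0) (rho_cont h hc.cont hc.bd hc.c0)
  have i2 := integrable_of_cont (m := μ0) (rho_cont h hd.cont hd.bd hd.c0)
  have hz : ∫ x, (rho δ φ c x - rho δ ψ d x) ∂μ0 = 0 := by
    rw [integral_sub i1 i2, hc.int, hd.int]; simp
  have hz2 := (integral_eq_zero_iff_of_nonneg (μ := μ0) (f := fun x => rho δ φ c x - rho δ ψ d x)
    (fun x => by have := hpt x; simp only [Pi.zero_apply]; linarith) (i1.sub i2)).1 hz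
  obtain ⟨x, hx⟩ := hz2.exists
  have := hpt x
  simp only [Pi.zero_apply] at hx
  linarith

lemma rho_diff {Ubar δ : ℝ} (h : Ubar < δ) (hU : 0 < Ubar) {μ0 : Measure Ω}
    [IsProbabilityMeasure μ0] {φ ψ : Ω → ℝ} {c d ε : ℝ}
    (hc : Adm Ubar δ μ0 φ c) (hd : Adm Ubar δ μ0 ψ d) (he : ∀ x, |φ x - ψ x| ≤ ε) (x : Ω) :
    |rho δ φ c x - rho δ ψ d x| ≤ 2 * δ / (δ - Ubar) ^ 2 * ε := by
  have hδ : 0 < δ := by linarith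
  have h1 := c_le h hU hc hd he
  have h2 := c_le h hU hd hc (fun x => by rw [abs_sub_comm]; exact he x)
  have hε : 0 ≤ ε := (abs_nonneg _).trans (he x)
  have p1 := den_pos h hc.bd hc.c0 x
  have p2 := den_pos h hd.bd hd.c0 x
  have q1 : δ - Ubar ≤ δ - (φ x - c) := by have := (hc.bd x).2; have := hc.c0; linarith
  have q2 : δ - Ubar ≤ δ - (ψ x - d) := by have := (hd.bd x).2; have := hd.c0; linarith
  have hs : 0 < δ - Ubar := by linarith
  have e : rho δ φ c x - rho δ ψ d x =
      δ * ((φ x - ψ x) - (c - d)) / ((δ - (φ x - c)) * (δ - (ψ x - d))) := by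
    unfold rho
    field_simp
    ring
  rw [e, abs_div, abs_mul, abs_of_pos hδ, abs_of_pos (mul_pos p1 p2)]
  have hn : |(φ x - ψ x) - (c - d)| ≤ 2 * ε := by
    have := abs_le.1 (he x)
    rw [abs_le]; constructor <;> linarith
  calc δ * |(φ x - ψ x) - (c - d)| / ((δ - (φ x - c)) * (δ - (ψ x - d)))
      ≤ δ * (2 * ε) / ((δ - Ubar) * (δ - Ubar)) := by gcongr
    _ = _ := by ring

lemma M_prob {Ubar δ : ℝ} (h : Ubar < δ) (hU : 0 < Ubar) {μ0 : Measure Ω}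
    [IsProbabilityMeasure μ0] {φ : Ω → ℝ} {c : ℝ}
    (hc : Adm Ubar δ μ0 φ c) : IsProbabilityMeasure (M δ μ0 φ c) := by
  constructor
  have i1 := integrable_of_cont (m := μ0) (rho_cont h hc.cont hc.bd hc.c0)
  rw [M, withDensity_apply _ MeasurableSet.univ, setLIntegral_univ,
    ← ofReal_integral_eq_lintegral_ofReal i1
      (Filter.Eventually.of_forall (rho_nonneg h hU hc.bd hc.c0)), hc.int]
  simp

lemma M_apply {Ubar δ : ℝ} (h : Ubar < δ) (hU : 0 < Ubar) {μ0 : Measure Ω}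
    [IsProbabilityMeasure μ0] {φ : Ω → ℝ} {c : ℝ} (hφ : Continuous φ)
    (bd : ∀ x, 0 ≤ φ x ∧ φ x ≤ Ubar) (hc : 0 ≤ c) {A : Set Ω} (hA : MeasurableSet A) :
    M δ μ0 φ c A = ENNReal.ofReal (∫ x in A, rho δ φ c x ∂μ0) := by
  have i1 := integrable_of_cont (m := μ0) (rho_cont h hφ bd hc)
  rw [M, withDensity_apply _ hA,
    ← ofReal_integral_eq_lintegral_ofReal i1.integrableOn
      (Filter.Eventually.of_forall (rho_nonneg h hU bd hc))]

lemma M_integral {Ubar δ : ℝ} (h : Ubar < δ) (hU : 0 < Ubar) {μ0 : Measure Ω}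
    [IsProbabilityMeasure μ0] {φ : Ω → ℝ} {c : ℝ}
    (hc : Adm Ubar δ μ0 φ c) (f : Ω → ℝ) :
    ∫ x, f x ∂(M δ μ0 φ c) = ∫ x, rho δ φ c x * f x ∂μ0 := by
  have hm := (rho_cont h hc.cont hc.bd hc.c0).measurable
  rw [M, integral_withDensity_eq_integral_toReal_smul (by fun_prop)
    (Filter.Eventually.of_forall (fun x => ENNReal.ofReal_lt_top))]
  refine integral_congr_ae (Filter.Eventually.of_forall fun x => ?_)
  simp only [smul_eq_mul, ENNReal.toReal_ofReal (rho_nonneg h hU hc.bd hc.c0 x)]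

lemma M_mean {Ubar δ : ℝ} (h : Ubar < δ) (hU : 0 < Ubar) {μ0 : Measure Ω}
    [IsProbabilityMeasure μ0] {φ : Ω → ℝ} {c : ℝ}
    (hc : Adm Ubar δ μ0 φ c) : ∫ x, φ x ∂(M δ μ0 φ c) = c := by
  rw [M_integral h hU hc]
  have i1 := integrable_of_cont (m := μ0) (rho_cont h hc.cont hc.bd hc.c0)
  have e : ∀ x, rho δ φ c x * φ x = (δ + c) * rho δ φ c x - δ := by
    intro x
    have := (den_pos h hc.bd hc.c0 x).ne'
    unfold rho
    field_simp
    ring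
  simp_rw [e]
  rw [integral_sub (i1.const_mul _) (integrable_const _), integral_const_mul, hc.int]
  simp

lemma TV_le {Ubar δ : ℝ} (h : Ubar < δ) (hU : 0 < Ubar) {μ0 : Measure Ω}
    [IsProbabilityMeasure μ0] {φ ψ : Ω → ℝ} {c d K : ℝ}
    (hc : Adm Ubar δ μ0 φ c) (hd : Adm Ubar δ μ0 ψ d) (hK : 0 ≤ K)
    (he : ∀ x, |rho δ φ c x - rho δ ψ d x| ≤ K) :
    TV (M δ μ0 φ c) (M δ μ0 ψ d) ≤ K := by
  have hm := (rho_cont h hc.cont hc.bd hc.c0).measurable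
  have hm' := (rho_cont h hd.cont hd.bd hd.c0).measurable
  have key : ∀ f g : Ω → ℝ, Measurable f → Measurable g → 
      (μ0.withDensity (fun x => ENNReal.ofReal (f x)) -
        μ0.withDensity (fun x => ENNReal.ofReal (g x))) Set.univ ≤
        ∫⁻ x, ENNReal.ofReal (f x - g x) ∂μ0 := by
    intro f g hf hg
    have : μ0.withDensity (fun x => ENNReal.ofReal (f x)) -
        μ0.withDensity (fun x => ENNReal.ofReal (g x)) ≤
        μ0.withDensity (fun x => ENNReal.ofReal (f x - g x)) := by
      apply Measure.sub_le_of_le_add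
      rw [← withDensity_add_left (by fun_prop)]
      apply withDensity_mono
      refine Filter.Eventually.of_forall fun x => ?_
      simp only [Pi.add_apply]
      calc ENNReal.ofReal (f x) = ENNReal.ofReal ((f x - g x) + g x) := by ring_nf
        _ ≤ _ := ENNReal.ofReal_add_le
    refine (this _).trans ?_
    rw [withDensity_apply _ MeasurableSet.univ, setLIntegral_univ]
  unfold TV
  apply ENNReal.toReal_le_of_le_ofReal hK
  refine (add_le_add (key _ _ hm hm') (key _ _ hm' hm)).trans ?_
  rw [← lintegral_add_left (by fun_prop)]
  calc _ ≤ ∫⁻ x : Ω, ENNReal.ofReal K ∂μ0 := by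
        apply lintegral_mono
        intro x
        have := abs_le.1 (he x)
        rcases le_total (rho δ φ c x) (rho δ ψ d x) with hh | hh
        · simp only
          rw [ENNReal.ofReal_of_nonpos (sub_nonpos.2 hh), zero_add]
          exact ENNReal.ofReal_le_ofReal (by linarith)
        · simp only
          rw [ENNReal.ofReal_of_nonpos (sub_nonpos.2 hh), add_zero]
          exact ENNReal.ofReal_le_ofReal (by linarith)
    _ = _ := by simp

/-- The right-hand side of the equation for `Φ`. -/
noncomputable def G (δ : ℝ) (U : Ω → Measure Ω → ℝ) (m : Measure Ω) (φ : Ω → ℝ) (x : Ω) : ℝ :=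
  U x m + (1 / (2 * δ)) * ∫ z, (max (φ z - φ x) 0) ^ 2 ∂m

lemma sq_diff {Ubar a b ε : ℝ} (ha : a ≤ Ubar) (hb : b ≤ Ubar) (hU : 0 < Ubar)
    (he : |a - b| ≤ 2 * ε) : |(max a 0) ^ 2 - (max b 0) ^ 2| ≤ 4 * Ubar * ε := by
  have e : (max a 0) ^ 2 - (max b 0) ^ 2 = (max a 0 - max b 0) * (max a 0 + max b 0) := by ring
  have h1 : |max a 0 - max b 0| ≤ 2 * ε := (abs_max_sub_max_le_abs a b 0).trans he
  have a0 : 0 ≤ max a 0 := le_max_right _ _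
  have b0 : 0 ≤ max b 0 := le_max_right _ _
  have a1 : max a 0 ≤ Ubar := max_le ha hU.le
  have b1 : max b 0 ≤ Ubar := max_le hb hU.le
  rw [e, abs_mul, abs_of_nonneg (add_nonneg a0 b0)]
  calc _ ≤ (2 * ε) * (Ubar + Ubar) := by
        apply mul_le_mul h1 (by linarith) (by linarith) ((abs_nonneg _).trans h1)
    _ = _ := by ring

lemma G_diff {Ubar δ LU : ℝ} (h : Ubar < δ) (hU : 0 < Ubar) (hLU : 0 < LU) {μ0 : Measure Ω}
    [IsProbabilityMeasure μ0] {U : Ω → Measure Ω → ℝ}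
    (hUL : ∀ (x : Ω) (m ν : Measure Ω), IsProbabilityMeasure m →
      IsProbabilityMeasure ν → |U x m - U x ν| ≤ LU * TV m ν)
    {φ ψ : Ω → ℝ} {c d ε : ℝ}
    (hc : Adm Ubar δ μ0 φ c) (hd : Adm Ubar δ μ0 ψ d) (he : ∀ x, |φ x - ψ x| ≤ ε) (x : Ω) :
    |G δ U (M δ μ0 φ c) φ x - G δ U (M δ μ0 ψ d) ψ x| ≤
      ((LU + Ubar ^ 2 / (2 * δ)) * (2 * δ / (δ - Ubar) ^ 2) + 2 * Ubar / δ) * ε := by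
  have hδ : 0 < δ := by linarith
  have hε : 0 ≤ ε := (abs_nonneg _).trans (he x)
  have hs : 0 < δ - Ubar := by linarith
  set K := 2 * δ / (δ - Ubar) ^ 2 * ε with hKdef
  have hK : 0 ≤ K := by positivity
  have hr := rho_diff h hU hc hd he
  have pm := M_prob h hU hc
  have pn := M_prob h hU hd
  have hT := TV_le h hU hc hd hK hr
  have hU1 : |U x (M δ μ0 φ c) - U x (M δ μ0 ψ d)| ≤ LU * K :=
    (hUL x _ _ pm pn).trans (by gcongr)
  have cf : Continuous fun z => (max (φ z - φ x) 0) ^ 2 := by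
    have := hc.cont; fun_prop
  have cg : Continuous fun z => (max (ψ z - ψ x) 0) ^ 2 := by
    have := hd.cont; fun_prop
  have r1 := rho_cont h hc.cont hc.bd hc.c0
  have r2 := rho_cont h hd.cont hd.bd hd.c0
  -- change of measure
  have hA : |∫ z, (max (φ z - φ x) 0) ^ 2 ∂(M δ μ0 φ c) -
      ∫ z, (max (φ z - φ x) 0) ^ 2 ∂(M δ μ0 ψ d)| ≤ Ubar ^ 2 * K := by
    have j1 : Integrable (fun z => rho δ φ c z * (max (φ z - φ x) 0) ^ 2) μ0 :=
      integrable_of_cont (r1.mul cf)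
    have j2 : Integrable (fun z => rho δ ψ d z * (max (φ z - φ x) 0) ^ 2) μ0 :=
      integrable_of_cont (r2.mul cf)
    rw [M_integral h hU hc, M_integral h hU hd, ← integral_sub j1 j2]
    have := norm_integral_le_of_norm_le_const (μ := μ0) (C := Ubar ^ 2 * K)
      (f := fun z => rho δ φ c z * (max (φ z - φ x) 0) ^ 2 -
        rho δ ψ d z * (max (φ z - φ x) 0) ^ 2)
      (Filter.Eventually.of_forall fun z => by
        rw [← sub_mul, Real.norm_eq_abs, abs_mul, mul_comm]
        have m1 : max (φ z - φ x) 0 ≤ Ubar :=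
          max_le (by have := hc.bd z; have := hc.bd x; linarith) hU.le
        have m0 : 0 ≤ max (φ z - φ x) 0 := le_max_right _ _
        rw [abs_of_nonneg (by positivity : 0 ≤ (max (φ z - φ x) 0) ^ 2)]
        have := hr z
        gcongr)
    simpa using this
  have hB : |∫ z, (max (φ z - φ x) 0) ^ 2 ∂(M δ μ0 ψ d) -
      ∫ z, (max (ψ z - ψ x) 0) ^ 2 ∂(M δ μ0 ψ d)| ≤ 4 * Ubar * ε := by
    rw [← integral_sub (integrable_of_cont cf) (integrable_of_cont cg)]
    have := norm_integral_le_of_norm_le_const (μ := M δ μ0 ψ d) (C := 4 * Ubar * ε)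
      (f := fun z => (max (φ z - φ x) 0) ^ 2 - (max (ψ z - ψ x) 0) ^ 2)
      (Filter.Eventually.of_forall fun z => by
        rw [Real.norm_eq_abs]
        apply sq_diff _ _ hU
        · have a1 := abs_le.1 (he z)
          have a2 := abs_le.1 (he x)
          rw [abs_le]; constructor <;> linarith
        · have := hc.bd z; have := hc.bd x; linarith
        · have := hd.bd z; have := hd.bd x; linarith)
    simpa using this
  have hAB := (abs_sub_le _ _ _).trans (add_le_add hA hB)
  have e : G δ U (M δ μ0 φ c) φ x - G δ U (M δ μ0 ψ d) ψ x =
      (U x (M δ μ0 φ c) - U x (M δ μ0 ψ d)) + (1 / (2 * δ)) *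
      (∫ z, (max (φ z - φ x) 0) ^ 2 ∂(M δ μ0 φ c) -
      ∫ z, (max (ψ z - ψ x) 0) ^ 2 ∂(M δ μ0 ψ d)) := by
    unfold G; ring
  rw [e]
  refine (abs_add_le _ _).trans ?_
  rw [abs_mul, abs_of_pos (by positivity : 0 < 1 / (2 * δ))]
  calc _ ≤ LU * K + 1 / (2 * δ) * (Ubar ^ 2 * K + 4 * Ubar * ε) := by gcongr
    _ = _ := by rw [hKdef]; field_simp; ring

lemma G_cont {δ : ℝ} {U : Ω → Measure Ω → ℝ} 
    (hUc : ∀ m : Measure Ω, IsProbabilityMeasure m → Continuous fun x => U x m)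
    {m : Measure Ω} (hm : IsProbabilityMeasure m) {Ubar : ℝ} (hU : 0 < Ubar)
    {φ : Ω → ℝ} (hφ : Continuous φ) (bd : ∀ x, 0 ≤ φ x ∧ φ x ≤ Ubar) :
    Continuous (G δ U m φ) := by
  unfold G
  refine (hUc m hm).add (continuous_const.mul ?_)
  apply continuous_of_dominated (bound := fun _ => Ubar ^ 2)
  · intro x
    exact Continuous.aestronglyMeasurable (by fun_prop)
  · intro x
    refine Filter.Eventually.of_forall fun z => ?_
    have m1 : max (φ z - φ x) 0 ≤ Ubar :=
      max_le (by have := bd z; have := bd x; linarith) hU.le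
    have m0 : 0 ≤ max (φ z - φ x) 0 := le_max_right _ _
    rw [Real.norm_of_nonneg (by positivity)]
    gcongr
  · exact integrable_const _
  · exact Filter.Eventually.of_forall fun z => by fun_prop

lemma G_nonneg {δ : ℝ} (hδ : 0 < δ) {U : Ω → Measure Ω → ℝ} {Ubar : ℝ}
    (hUb : ∀ (x : Ω) (m : Measure Ω), IsProbabilityMeasure m →
      0 ≤ U x m ∧ U x m ≤ Ubar)
    {m : Measure Ω} (hm : IsProbabilityMeasure m) (φ : Ω → ℝ) (x : Ω) :
    0 ≤ G δ U m φ x := by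
  unfold G
  have := (hUb x m hm).1
  have : 0 ≤ ∫ z, (max (φ z - φ x) 0) ^ 2 ∂m := integral_nonneg fun z => by positivity
  positivity

/-- A solution gives an admissible pair. -/
lemma sol_adm {Ubar δ : ℝ} (h : Ubar < δ) (hU : 0 < Ubar) {U : Ω → Measure Ω → ℝ}
    {μ0 : Measure Ω} [IsProbabilityMeasure μ0]
    {p : Measure Ω × (Ω → ℝ)} (hp : MFGSol Ubar δ U μ0 p) :
    ∃ c, Adm Ubar δ μ0 p.2 c ∧ p.1 = M δ μ0 p.2 c ∧ ∀ x, p.2 x = G δ U p.1 p.2 x := by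
  obtain ⟨hm, hφ, bd, hA, hG⟩ := hp
  have hc : 0 ≤ ∫ z, p.2 z ∂p.1 := integral_nonneg fun z => (bd z).1
  have hM : p.1 = M δ μ0 p.2 (∫ z, p.2 z ∂p.1) := by
    ext A hAm
    rw [M_apply h hU hφ bd hc hAm, hA A hAm]
    rfl
  refine ⟨∫ z, p.2 z ∂p.1, ⟨hφ, bd, hc, ?_⟩, hM, hG⟩
  have h1 := hA Set.univ MeasurableSet.univ
  rw [measure_univ, setIntegral_univ] at h1
  have := congrArg ENNReal.toReal h1
  rw [ENNReal.toReal_one, ENNReal.toReal_ofReal] at this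
  · exact this.symm
  · exact integral_nonneg (rho_nonneg h hU bd hc)

lemma adm_sol {Ubar δ : ℝ} (h : Ubar < δ) (hU : 0 < Ubar) {U : Ω → Measure Ω → ℝ}
    {μ0 : Measure Ω} [IsProbabilityMeasure μ0] {φ : Ω → ℝ} {c : ℝ}
    (hc : Adm Ubar δ μ0 φ c) (hG : ∀ x, φ x = G δ U (M δ μ0 φ c) φ x) :
    MFGSol Ubar δ U μ0 (M δ μ0 φ c, φ) := by
  refine ⟨M_prob h hU hc, hc.cont, hc.bd, ?_, hG⟩
  intro A hA
  simp only
  rw [M_mean h hU hc, M_apply h hU hc.cont hc.bd hc.c0 hA]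
  rfl

/-- Existence through the truncated contraction. -/
lemma exists_sol {Ubar δ C : ℝ} (h : Ubar < δ) (hU : 0 < Ubar) (μ0 : Measure Ω)
    [IsProbabilityMeasure μ0] {U : Ω → Measure Ω → ℝ}
    (hUc : ∀ m : Measure Ω, IsProbabilityMeasure m → Continuous fun x => U x m)
    (hUb : ∀ (x : Ω) (m : Measure Ω), IsProbabilityMeasure m →
      0 ≤ U x m ∧ U x m ≤ Ubar)
    (hC0 : 0 ≤ C) (hC1 : C < 1)
    (hdiff : ∀ (φ ψ : Ω → ℝ) (c d ε : ℝ), Adm Ubar δ μ0 φ c → Adm Ubar δ μ0 ψ d →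
      (∀ x, |φ x - ψ x| ≤ ε) → ∀ x,
      |G δ U (M δ μ0 φ c) φ x - G δ U (M δ μ0 ψ d) ψ x| ≤ C * ε) :
    ∃ (φ : Ω → ℝ) (c : ℝ), Adm Ubar δ μ0 φ c ∧ ∀ x, φ x = G δ U (M δ μ0 φ c) φ x := by
  have hδ : 0 < δ := by linarith
  let S : Set C(Ω, ℝ) := {f | ∀ x, 0 ≤ f x ∧ f x ≤ Ubar}
  have hS : IsClosed S := by
    have : S = ⋂ x, {f : C(Ω, ℝ) | f x ∈ Set.Icc 0 Ubar} := by
      ext f; simp [S]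
    rw [this]
    exact isClosed_iInter fun x => isClosed_Icc.preimage (by fun_prop)
  haveI : CompleteSpace S := hS.completeSpace_coe
  haveI : Nonempty S := ⟨⟨0, fun x => ⟨le_rfl, hU.le⟩⟩⟩
  have hex : ∀ f : S, ∃ c, Adm Ubar δ μ0 (f : C(Ω, ℝ)) c :=
    fun f => exists_c h hU μ0 f.1.continuous f.2
  choose c hc using hex
  let T : S → S := fun f => ⟨⟨fun x => min Ubar (G δ U (M δ μ0 f.1 (c f)) f.1 x),
      continuous_const.min (G_cont hUc (M_prob h hU (hc f)) hU f.1.continuous f.2)⟩,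
      fun x => ⟨le_min hU.le (G_nonneg hδ hUb (M_prob h hU (hc f)) _ x), min_le_left _ _⟩⟩
  have hT : ContractingWith C.toNNReal T := by
    refine ⟨by rwa [Real.toNNReal_lt_one], ?_⟩
    apply LipschitzWith.of_dist_le_mul
    intro f g
    rw [Real.coe_toNNReal _ hC0, Subtype.dist_eq, Subtype.dist_eq,
      ContinuousMap.dist_le (by positivity)]
    intro x
    have := hdiff f.1 g.1 (c f) (c g) (dist f.1 g.1) (hc f) (hc g)
      (fun x => by rw [← Real.dist_eq]; exact ContinuousMap.dist_apply_le_dist x) x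
    refine le_trans ?_ this
    rw [Real.dist_eq]
    show |min Ubar (G δ U (M δ μ0 f.1 (c f)) f.1 x) -
      min Ubar (G δ U (M δ μ0 g.1 (c g)) g.1 x)| ≤ _
    refine (abs_min_sub_min_le_max _ _ _ _).trans ?_
    simp
  let f := hT.fixedPoint
  have hf : T f = f := hT.fixedPoint_isFixedPt
  refine ⟨f.1, c f, hc f, fun x => ?_⟩
  have hx : min Ubar (G δ U (M δ μ0 f.1 (c f)) f.1 x) = f.1 x :=
    congrArg (fun g : S => g.1 x) hf
  rcases le_total (G δ U (M δ μ0 f.1 (c f)) f.1 x) Ubar with hle | hle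
  · rw [min_eq_right hle] at hx
    exact hx.symm
  · rw [min_eq_left hle] at hx
    have hz : G δ U (M δ μ0 f.1 (c f)) f.1 x = U x (M δ μ0 f.1 (c f)) := by
      unfold G
      have : ∀ z, max (f.1 z - f.1 x) 0 = 0 := fun z =>
        max_eq_right (by have := (f.2 z).2; linarith)
      simp [this]
    have := (hUb x _ (M_prob h hU (hc f))).2
    linarith

end MFGAux

open MFGAux in
/-- **Proposition 4: well-posedness of the stationary mean field game system
(exchangeable case).** -/
theorem stmt8
    (Ubar LU : ℝ) (hUbar : 0 < Ubar) (hLU : 0 < LU)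
    (U : Ω → Measure Ω → ℝ)
    (hUc : ∀ m : Measure Ω, IsProbabilityMeasure m → Continuous fun x => U x m)
    (hUb : ∀ (x : Ω) (m : Measure Ω), IsProbabilityMeasure m →
      0 ≤ U x m ∧ U x m ≤ Ubar)
    (hUL : ∀ (x : Ω) (m ν : Measure Ω), IsProbabilityMeasure m →
      IsProbabilityMeasure ν → |U x m - U x ν| ≤ LU * TV m ν)
    (μ0 : Measure Ω) [IsProbabilityMeasure μ0]
    (δ : ℝ) (hδ : (3 + Real.sqrt 5) / 2 * Ubar < δ)
    (hCδ : (LU + Ubar ^ 2 / (2 * δ)) * (1 - δ * Ubar / (δ - Ubar) ^ 2)⁻¹ *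
      (2 * δ / (δ - Ubar) ^ 2) + 2 * Ubar / δ < 1) :
    (∃! p : Measure Ω × (Ω → ℝ), MFGSol Ubar δ U μ0 p) ∧
    (∀ p : Measure Ω × (Ω → ℝ), MFGSol Ubar δ U μ0 p → p.1 ≪ μ0) := by
  have h5 : 0 ≤ Real.sqrt 5 := Real.sqrt_nonneg 5
  have h55 : Real.sqrt 5 ^ 2 = 5 := Real.sq_sqrt (by norm_num)
  have h : Ubar < δ := by nlinarith
  have hδ0 : 0 < δ := by linarith
  have hs : 0 < δ - Ubar := by linarith
  have hq : δ * Ubar < (δ - Ubar) ^ 2 := by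
    have a1 : 0 < δ - (3 + Real.sqrt 5) / 2 * Ubar := by linarith
    have a2 : 0 < δ - (3 - Real.sqrt 5) / 2 * Ubar := by nlinarith
    have := mul_pos a1 a2
    nlinarith
  have hr1 : δ * Ubar / (δ - Ubar) ^ 2 < 1 := by
    rw [div_lt_one (by positivity)]; exact hq
  have hr0 : 0 < δ * Ubar / (δ - Ubar) ^ 2 := by positivity
  have hinv : 1 ≤ (1 - δ * Ubar / (δ - Ubar) ^ 2)⁻¹ := by
    rw [one_le_inv₀ (by linarith)]; linarith
  set C := (LU + Ubar ^ 2 / (2 * δ)) * (2 * δ / (δ - Ubar) ^ 2) + 2 * Ubar / δ with hC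
  have hC0 : 0 ≤ C := by positivity
  have hC1 : C < 1 := by
    refine lt_of_le_of_lt ?_ hCδ
    rw [hC]
    gcongr
    exact le_mul_of_one_le_right (by positivity) hinv
  have hdiff : ∀ (φ ψ : Ω → ℝ) (c d ε : ℝ), Adm Ubar δ μ0 φ c → Adm Ubar δ μ0 ψ d →
      (∀ x, |φ x - ψ x| ≤ ε) → ∀ x,
      |G δ U (M δ μ0 φ c) φ x - G δ U (M δ μ0 ψ d) ψ x| ≤ C * ε :=
    fun φ ψ c d ε hc hd he x => G_diff h hUbar hLU hUL hc hd he x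
  refine ⟨?_, ?_⟩
  · obtain ⟨φ, c, hc, hG⟩ := exists_sol h hUbar μ0 hUc hUb hC0 hC1 hdiff
    refine ⟨(M δ μ0 φ c, φ), adm_sol h hUbar hc hG, ?_⟩
    rintro ⟨m, ψ⟩ hp
    obtain ⟨d, hd, hm, hGd⟩ := sol_adm h hUbar hp
    simp only at hd hm hGd
    subst hm
    let f : C(Ω, ℝ) := ⟨φ, hc.cont⟩
    let g : C(Ω, ℝ) := ⟨ψ, hd.cont⟩
    have hle : dist g f ≤ C * dist g f := by
      rw [ContinuousMap.dist_le (by positivity)]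
      intro x
      have := hdiff ψ φ d c (dist g f) hd hc
        (fun x => by
          rw [← Real.dist_eq]; exact ContinuousMap.dist_apply_le_dist (f := g) (g := f) x) x
      rw [← hG, ← hGd] at this
      rw [Real.dist_eq]
      exact this
    have hz : dist g f = 0 := by
      have := dist_nonneg (x := g) (y := f)
      nlinarith
    have hfg : ψ = φ := congrArg (fun k : C(Ω, ℝ) => (k : Ω → ℝ)) (dist_eq_zero.1 hz)
    subst hfg
    have e1 := c_le (ε := 0) h hUbar hc hd (fun x => by simp)
    have e2 := c_le (ε := 0) h hUbar hd hc (fun x => by simp)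
    have : c = d := by linarith
    rw [this]
  · intro p hp
    obtain ⟨d, hd, hm, hGd⟩ := sol_adm h hUbar hp
    rw [hm]
    exact withDensity_absolutelyContinuous _ _
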